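/- Let a, b be real numbers with a < b. Then the function w ↦ log(Φ(b − w) − Φ(a − w)) is concave on ℝ. Equivalently, the Gaussian interval probability w ↦ P(a ≤ Z + w ≤ b), where Z is standard normal, is a log-concave function of w. -/

import Mathlib

open MeasureTheory Real

/-- Standard normal density on ℝ. -/
noncomputable def stdPdf (t : ℝ) : ℝ := (Real.sqrt (2 * Real.pi))⁻¹ * Real.exp (-t ^ 2 / 2)

/-- Standard normal cumulative distribution function Φ. -/
noncomputable def Phi (t : ℝ) : ℝ := ∫ s in Set.Iic t, stdPdf s

lemma stdPdf_pos (t : ℝ) : 0 < stdPdf t := by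
  unfold stdPdf
  positivity

lemma continuous_stdPdf : Continuous stdPdf := by
  unfold stdPdf
  fun_prop

lemma integrable_stdPdf : Integrable stdPdf := by
  have h := (integrable_exp_neg_mul_sq (b := 1 / 2) (by norm_num)).const_mul (√(2 * π))⁻¹
  refine h.congr (.of_forall fun t => ?_)
  simp only [stdPdf]
  ring_nf

lemma hasDerivAt_stdPdf (t : ℝ) : HasDerivAt stdPdf (-(t * stdPdf t)) t := by
  have h := ((((hasDerivAt_id t).pow 2).neg.div_const 2).exp).const_mul (√(2 * π))⁻¹
  refine h.congr_deriv ?_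
  simp only [stdPdf, id, Pi.pow_apply, Pi.neg_apply]
  ring

lemma Phi_sub_Phi (x y : ℝ) : Phi y - Phi x = ∫ t in x..y, stdPdf t :=
  intervalIntegral.integral_Iic_sub_Iic integrable_stdPdf.integrableOn
    integrable_stdPdf.integrableOn

lemma hasDerivAt_Phi (t : ℝ) : HasDerivAt Phi (stdPdf t) t := by
  have h := (intervalIntegral.integral_hasDerivAt_right
    (continuous_stdPdf.intervalIntegrable 0 t)
    (continuous_stdPdf.stronglyMeasurableAtFilter _ _) continuous_stdPdf.continuousAt).const_add (Phi 0)
  refine h.congr_of_eventuallyEq (.of_forall fun s => ?_)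
  simp only [← Phi_sub_Phi]
  ring

lemma Phi_sub_Phi_pos {x y : ℝ} (h : x < y) : 0 < Phi y - Phi x := by
  rw [Phi_sub_Phi]
  exact intervalIntegral.intervalIntegral_pos_of_pos
    (continuous_stdPdf.intervalIntegrable x y) stdPdf_pos h

lemma integral_mul_stdPdf (x y : ℝ) : ∫ t in x..y, t * stdPdf t = stdPdf x - stdPdf y := by
  rw [intervalIntegral.integral_eq_sub_of_hasDerivAt (f := fun t => -stdPdf t)
    (f' := fun t => t * stdPdf t)
    (fun t _ => (hasDerivAt_stdPdf t).neg.congr_deriv (neg_neg _))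
    ((continuous_id.mul continuous_stdPdf).intervalIntegrable x y)]
  ring

lemma mul_Phi_sub_Phi_le {x y : ℝ} (h : x ≤ y) :
    x * (Phi y - Phi x) ≤ stdPdf x - stdPdf y := by
  rw [Phi_sub_Phi, ← integral_mul_stdPdf, ← intervalIntegral.integral_const_mul]
  exact intervalIntegral.integral_mono_on h
    ((continuous_const.mul continuous_stdPdf).intervalIntegrable x y)
    ((continuous_id.mul continuous_stdPdf).intervalIntegrable x y)
    fun t ht => mul_le_mul_of_nonneg_right ht.1 (stdPdf_pos t).le

lemma le_mul_Phi_sub_Phi {x y : ℝ} (h : x ≤ y) :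
    stdPdf x - stdPdf y ≤ y * (Phi y - Phi x) := by
  rw [Phi_sub_Phi, ← integral_mul_stdPdf, ← intervalIntegral.integral_const_mul]
  exact intervalIntegral.integral_mono_on h
    ((continuous_id.mul continuous_stdPdf).intervalIntegrable x y)
    ((continuous_const.mul continuous_stdPdf).intervalIntegrable x y)
    fun t ht => mul_le_mul_of_nonneg_right ht.2 (stdPdf_pos t).le

/-- for a < b, w ↦ log(Φ(b − w) − Φ(a − w)) is concave on ℝ;
equivalently, the Gaussian interval probability w ↦ P(a ≤ Z + w ≤ b) is log-concave in w. -/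
theorem gaussian_interval_logconcave (a b : ℝ) (hab : a < b) :
    ConcaveOn ℝ Set.univ (fun w : ℝ => Real.log (Phi (b - w) - Phi (a - w))) := by
  have hsub (c w : ℝ) : HasDerivAt (fun w : ℝ => c - w) (-1) w := by
    simpa using (hasDerivAt_id w).const_sub c
  have hlt (w : ℝ) : a - w < b - w := by linarith
  have hne (w : ℝ) : Phi (b - w) - Phi (a - w) ≠ 0 := (Phi_sub_Phi_pos (hlt w)).ne'
  have hP (w : ℝ) : HasDerivAt (fun w => Phi (b - w) - Phi (a - w))
      (stdPdf (a - w) - stdPdf (b - w)) w :=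
    (((hasDerivAt_Phi (b - w)).comp w (hsub b w)).sub
      ((hasDerivAt_Phi (a - w)).comp w (hsub a w))).congr_deriv (by ring)
  have hD (w : ℝ) : HasDerivAt (fun w => stdPdf (a - w) - stdPdf (b - w))
      ((a - w) * stdPdf (a - w) - (b - w) * stdPdf (b - w)) w :=
    (((hasDerivAt_stdPdf (a - w)).comp w (hsub a w)).sub
      ((hasDerivAt_stdPdf (b - w)).comp w (hsub b w))).congr_deriv (by ring)
  have h1 (w : ℝ) := (hP w).log (hne w)
  have h2 (w : ℝ) := (hD w).div (hP w) (hne w)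
  refine concaveOn_of_hasDerivWithinAt2_nonpos convex_univ
    (fun w _ => (h1 w).continuousAt.continuousWithinAt)
    (fun w _ => (h1 w).hasDerivWithinAt) (fun w _ => (h2 w).hasDerivWithinAt) fun w _ => ?_
  refine div_nonpos_of_nonpos_of_nonneg ?_ (sq_nonneg _)
  have hx := mul_nonneg (stdPdf_pos (a - w)).le (sub_nonneg.2 (mul_Phi_sub_Phi_le (hlt w).le))
  have hy := mul_nonneg (stdPdf_pos (b - w)).le (sub_nonneg.2 (le_mul_Phi_sub_Phi (hlt w).le))
  linarith
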